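/- Let B be a nonempty set, A ⊂ B nonempty, u : B → ℝ bounded, and set M := sup_B u, m := inf_B u. Suppose there is a constant C₁ ≥ 1 such that sup_A (M − u) ≤ C₁ inf_A (M − u) and sup_A (u − m) ≤ C₁ inf_A (u − m). Then osc_A u ≤ ((C₁ − 1)/(C₁ + 1)) osc_B u, where osc_E u := sup_E u − inf_E u. -/

import Mathlib

/-!
The oscillation-decay step in the proof of Lemma 3.3 of Li–Yang: if the Harnack
inequality (with constant `C₁`) holds on `A` both for `M − u` and for `u − m`, where
`M = sup_B u` and `m = inf_B u`, then `osc_A u ≤ ((C₁−1)/(C₁+1)) osc_B u`.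
-/

theorem statement11 {α : Type*} (A B : Set α) (u : α → ℝ)
    (hA : A.Nonempty) (hAB : A ⊆ B)
    (M m : ℝ) (hM : IsLUB (u '' B) M) (hm : IsGLB (u '' B) m)
    (C₁ : ℝ) (hC₁ : 1 ≤ C₁)
    -- `sup_A (M − u) ≤ C₁ inf_A (M − u)`
    (h₁ : ∀ x ∈ A, ∀ y ∈ A, M - u x ≤ C₁ * (M - u y))
    -- `sup_A (u − m) ≤ C₁ inf_A (u − m)`
    (h₂ : ∀ x ∈ A, ∀ y ∈ A, u x - m ≤ C₁ * (u y - m)) :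
    -- `osc_A u ≤ ((C₁−1)/(C₁+1)) osc_B u`
    ∀ x ∈ A, ∀ y ∈ A, u x - u y ≤ (C₁ - 1) / (C₁ + 1) * (M - m) := by
  intro x hx y hy
  have hM_u := h₁ y hy x hx
  have hu_m := h₂ x hx y hy
  rw [div_mul_eq_mul_div, le_div_iff₀ (by linarith)]
  linarith
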